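/- arXiv:2106.02507 — 2 statements merged into one kernel-verified Lean document; each statement's English description precedes it below -/
import Mathlib

section
/- (Two-dimensional oscillation decay) Let λ ∈ (0,1]. There exists δ ∈ (0,1) depending only on λ such that: for every measurable coefficient field a on B₁ ⊂ ℝ² that is uniformly elliptic with constant λ, every bounded weak solution v ∈ C¹(B₁) of div(a∇v) = 0 in B₁, and every r ∈ (0,1], one has osc_{B_{δr}} v ≤ (1/2) · osc_{B_r} v. -/
open MeasureTheory Metric

noncomputable section

/-- A coefficient field `a` on `U ⊆ ℝ²` is uniformly elliptic with constant `lam ∈ (0,1]`. -/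
def UniformlyElliptic (lam : ℝ) (U : Set (EuclideanSpace ℝ (Fin 2)))
    (a : EuclideanSpace ℝ (Fin 2) → Matrix (Fin 2) (Fin 2) ℝ) : Prop :=
  ∀ x ∈ U, (a x).IsSymm ∧
    ∀ ξ : EuclideanSpace ℝ (Fin 2),
      lam * ‖ξ‖ ^ 2 ≤ ∑ i, ∑ j, ξ i * a x i j * ξ j ∧
        ∑ i, ∑ j, ξ i * a x i j * ξ j ≤ lam⁻¹ * ‖ξ‖ ^ 2

/-- `v` is a weak solution of `div(a ∇v) = 0` in `U`. -/
def IsWeakSolution (U : Set (EuclideanSpace ℝ (Fin 2)))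
    (a : EuclideanSpace ℝ (Fin 2) → Matrix (Fin 2) (Fin 2) ℝ)
    (v : EuclideanSpace ℝ (Fin 2) → ℝ) : Prop :=
  ∀ φ : EuclideanSpace ℝ (Fin 2) → ℝ,
    ContDiff ℝ 1 φ → HasCompactSupport φ → tsupport φ ⊆ U →
      ∫ x in U, ∑ i, ∑ j, gradient φ x i * a x i j * gradient v x j = 0

/-- The oscillation of `v` over a set `S`: `sup_S v - inf_S v`. -/
def osc (v : EuclideanSpace ℝ (Fin 2) → ℝ) (S : Set (EuclideanSpace ℝ (Fin 2))) : ℝ :=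
  sSup (v '' S) - sInf (v '' S)


/-- The Euclidean plane. -/
abbrev Plane : Type := EuclideanSpace ℝ (Fin 2)

/-- The bilinear form `ξ · A ζ`. -/
def pairing (A : Matrix (Fin 2) (Fin 2) ℝ) (ξ ζ : Plane) : ℝ :=
  ∑ i, ∑ j, ξ i * A i j * ζ j

theorem pairing_add_left (A : Matrix (Fin 2) (Fin 2) ℝ) (ξ η ζ : Plane) :
    pairing A (ξ + η) ζ = pairing A ξ ζ + pairing A η ζ := by
  simp only [pairing, Fin.sum_univ_two, PiLp.add_apply]; ring

theorem pairing_smul_left (A : Matrix (Fin 2) (Fin 2) ℝ) (c : ℝ) (ξ ζ : Plane) :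
    pairing A (c • ξ) ζ = c * pairing A ξ ζ := by
  simp only [pairing, Fin.sum_univ_two, PiLp.smul_apply, smul_eq_mul]; ring

theorem pairing_smul_right (A : Matrix (Fin 2) (Fin 2) ℝ) (c : ℝ) (ξ ζ : Plane) :
    pairing A ξ (c • ζ) = c * pairing A ξ ζ := by
  simp only [pairing, Fin.sum_univ_two, PiLp.smul_apply, smul_eq_mul]; ring

@[simp] theorem pairing_zero_left (A : Matrix (Fin 2) (Fin 2) ℝ) (ζ : Plane) :
    pairing A 0 ζ = 0 := by
  simp [pairing]

section Ellipticity

variable {lam : ℝ} {U : Set Plane} {a : Plane → Matrix (Fin 2) (Fin 2) ℝ} {x : Plane}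

theorem UniformlyElliptic.lower (ha : UniformlyElliptic lam U a) (hx : x ∈ U) (ξ : Plane) :
    lam * ‖ξ‖ ^ 2 ≤ pairing (a x) ξ ξ :=
  ((ha x hx).2 ξ).1

theorem UniformlyElliptic.upper (ha : UniformlyElliptic lam U a) (hx : x ∈ U) (ξ : Plane) :
    pairing (a x) ξ ξ ≤ lam⁻¹ * ‖ξ‖ ^ 2 :=
  ((ha x hx).2 ξ).2

/-- Young's inequality for the quadratic form of an elliptic field. -/
theorem UniformlyElliptic.young (ha : UniformlyElliptic lam U a) (hlam : 0 < lam) (hx : x ∈ U)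
    (ξ ζ : Plane) :
    pairing (a x) ξ ζ ≤ 1 / 2 * pairing (a x) ξ ξ + 1 / 2 * pairing (a x) ζ ζ := by
  have h0 : 0 ≤ pairing (a x) (ξ - ζ) (ξ - ζ) :=
    le_trans (by positivity) (ha.lower hx (ξ - ζ))
  have hs : a x 1 0 = a x 0 1 := (ha x hx).1.apply 0 1
  simp only [pairing, Fin.sum_univ_two, PiLp.sub_apply] at h0 ⊢
  rw [hs] at h0 ⊢
  nlinarith

theorem UniformlyElliptic.abs_apply_le (ha : UniformlyElliptic lam U a) (hlam : 0 < lam)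
    (hx : x ∈ U) (i j : Fin 2) : |a x i j| ≤ lam⁻¹ := by
  have hs : a x 1 0 = a x 0 1 := (ha x hx).1.apply 0 1
  have key (s t : ℝ) : 0 ≤ s * s * a x 0 0 + 2 * (s * t * a x 0 1) + t * t * a x 1 1 ∧
      s * s * a x 0 0 + 2 * (s * t * a x 0 1) + t * t * a x 1 1 ≤ lam⁻¹ * (s ^ 2 + t ^ 2) := by
    have h1 := ha.lower hx !₂[s, t]
    have h2 := ha.upper hx !₂[s, t]
    have h3 : 0 ≤ lam * ‖(!₂[s, t] : Plane)‖ ^ 2 := by positivity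
    simp only [pairing, Fin.sum_univ_two, EuclideanSpace.norm_sq_eq, hs] at h1 h2 h3
    simp at h1 h2 h3
    constructor <;> nlinarith
  have h10 := key 1 0
  have h01 := key 0 1
  have h11 := key 1 1
  have h12 := key 1 (-1)
  rw [abs_le]
  fin_cases i <;> fin_cases j <;> simp [hs] <;> constructor <;> nlinarith

end Ellipticity

theorem hasDerivAt_sq_max_zero (t : ℝ) :
    HasDerivAt (fun t : ℝ => max t 0 ^ 2) (2 * max t 0) t := by
  rcases lt_trichotomy t 0 with ht | rfl | ht
  · rw [max_eq_right ht.le, mul_zero]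
    refine (hasDerivAt_const t (0 : ℝ)).congr_of_eventuallyEq ?_
    filter_upwards [eventually_lt_nhds ht] with s hs
    simp [max_eq_right hs.le]
  · have h : HasFDerivAt (fun t : ℝ => max t 0 ^ 2) (0 : ℝ →L[ℝ] ℝ) 0 := by
      refine Asymptotics.IsBigO.hasFDerivAt (n := 2) (Asymptotics.IsBigO.of_bound 1 ?_) one_lt_two
      filter_upwards with s
      rw [sub_zero, one_mul, norm_pow, norm_pow, norm_norm]
      gcongr
      rcases le_total s 0 with hs | hs <;> simp [hs]
    simpa using h.hasDerivAt
  · rw [max_eq_left ht.le]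
    refine ((hasDerivAt_pow 2 t).congr_of_eventuallyEq ?_).congr_deriv (by simp)
    filter_upwards [eventually_gt_nhds ht] with s hs
    simp [max_eq_left hs.le]

theorem contDiff_sq_max_zero : ContDiff ℝ 1 (fun t : ℝ => max t 0 ^ 2) := by
  rw [contDiff_one_iff_deriv]
  refine ⟨fun t => (hasDerivAt_sq_max_zero t).differentiableAt, ?_⟩
  rw [funext fun t => (hasDerivAt_sq_max_zero t).deriv]
  fun_prop

theorem measurable_gradient (v : Plane → ℝ) : Measurable (gradient v) :=
  (InnerProductSpace.toDual ℝ Plane).symm.continuous.measurable.comp (measurable_fderiv ℝ v)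

section SmoothOnBall

variable {v : Plane → ℝ} (hv : ContDiffOn ℝ 1 v (ball (0 : Plane) 1))
include hv

theorem ContDiffOn.contDiffAt_of_mem_ball {x : Plane} (hx : x ∈ ball (0 : Plane) 1) :
    ContDiffAt ℝ 1 v x :=
  hv.contDiffAt (isOpen_ball.mem_nhds hx)

theorem ContDiffOn.hasFDerivAt_of_mem_ball {x : Plane} (hx : x ∈ ball (0 : Plane) 1) :
    HasFDerivAt v (fderiv ℝ v x) x :=
  ((hv.contDiffAt_of_mem_ball hx).differentiableAt one_ne_zero).hasFDerivAt

theorem ContDiffOn.continuousOn_gradient : ContinuousOn (gradient v) (ball (0 : Plane) 1) :=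
  (InnerProductSpace.toDual ℝ Plane).symm.continuous.comp_continuousOn
    (hv.continuousOn_fderiv_of_isOpen isOpen_ball le_rfl)

/-- The integrand of the weak formulation is integrable. -/
theorem ContDiffOn.integrableOn_pairing {lam : ℝ} {a : Plane → Matrix (Fin 2) (Fin 2) ℝ}
    (hlam : 0 < lam) (ham : ∀ i j, Measurable fun x => a x i j)
    (ha : UniformlyElliptic lam (ball (0 : Plane) 1) a) {φ : Plane → ℝ} (hφ : ContDiff ℝ 1 φ)
    (hc : HasCompactSupport φ) (hs : tsupport φ ⊆ ball (0 : Plane) 1) :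
    IntegrableOn (fun x => pairing (a x) (gradient φ x) (gradient v x)) (ball (0 : Plane) 1) := by
  refine IntegrableOn.of_forall_sdiff_eq_zero (s := tsupport φ) ?_ measurableSet_ball ?_
  · refine integrable_finsetSum _ fun i _ => integrable_finsetSum _ fun j _ => ?_
    have hg : IntegrableOn (fun x => gradient φ x i * gradient v x j) (tsupport φ) := by
      refine ContinuousOn.integrableOn_compact hc ?_
      have h1 : ContinuousOn (gradient φ) (tsupport φ) :=
        (hφ.contDiffOn.continuousOn_gradient).mono hs
      have h2 : ContinuousOn (gradient v) (tsupport φ) := hv.continuousOn_gradient.mono hs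
      fun_prop
    have := Integrable.bdd_mul (c := lam⁻¹) hg (f := fun x => a x i j)
      (ham i j).aestronglyMeasurable (by
        filter_upwards [ae_restrict_mem (isClosed_tsupport φ).measurableSet] with x hx
        exact ha.abs_apply_le hlam (hs hx) i j)
    refine this.congr (Filter.Eventually.of_forall fun x => ?_)
    simp only
    ring
  · intro x hx
    have h0 : fderiv ℝ φ x = 0 := by
      by_contra h
      exact hx.2 (support_fderiv_subset ℝ h)
    simp [gradient, h0]

end SmoothOnBall

theorem isWeakSolution_iff {U : Set Plane} {a : Plane → Matrix (Fin 2) (Fin 2) ℝ} {v : Plane → ℝ} :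
    IsWeakSolution U a v ↔ ∀ φ : Plane → ℝ, ContDiff ℝ 1 φ → HasCompactSupport φ →
      tsupport φ ⊆ U → ∫ x in U, pairing (a x) (gradient φ x) (gradient v x) = 0 :=
  Iff.rfl

theorem gradient_neg_fun (v : Plane → ℝ) (x : Plane) :
    gradient (fun y => -v y) x = -gradient v x := by
  have : fderiv ℝ (fun y => -v y) x = -fderiv ℝ v x := fderiv_neg
  simp [gradient, this]

theorem IsWeakSolution.neg {U : Set Plane} {a : Plane → Matrix (Fin 2) (Fin 2) ℝ} {v : Plane → ℝ}
    (h : IsWeakSolution U a v) : IsWeakSolution U a (fun x => -v x) := by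
  rw [isWeakSolution_iff] at h ⊢
  intro φ h1 h2 h3
  have h4 (x : Plane) : pairing (a x) (gradient φ x) (gradient (fun y => -v y) x) =
      -pairing (a x) (gradient φ x) (gradient v x) := by
    rw [gradient_neg_fun, ← neg_one_smul ℝ, pairing_smul_right, neg_one_mul]
  simp only [h4, integral_neg, h φ h1 h2 h3, neg_zero]

section WeakSolution

variable {lam : ℝ} {a : Plane → Matrix (Fin 2) (Fin 2) ℝ} {v : Plane → ℝ} (hlam : 0 < lam)
  (ham : ∀ i j, Measurable fun x => a x i j)
  (ha : UniformlyElliptic lam (ball (0 : Plane) 1) a)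
  (hv : ContDiffOn ℝ 1 v (ball (0 : Plane) 1))
  (hw : IsWeakSolution (ball (0 : Plane) 1) a v)
include hlam ham ha hv hw

/-- The weak maximum principle on a disc: if `v < k` on the circle of radius `s`, then `v ≤ k`
inside. -/
theorem le_of_forall_norm_eq_lt {s k : ℝ} (hs : s < 1)
    (hk : ∀ p : Plane, ‖p‖ = s → v p < k) {x₀ : Plane} (hx₀ : x₀ ∈ ball (0 : Plane) s) :
    v x₀ ≤ k := by
  classical
  by_contra! hlt
  set φ : Plane → ℝ := (ball (0 : Plane) s).indicator fun x => max (v x - k) 0 ^ 2 with hφ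
  have hsub : closedBall (0 : Plane) s ⊆ ball 0 1 := closedBall_subset_ball hs
  have hsub' : ball (0 : Plane) s ⊆ ball 0 1 := ball_subset_ball hs.le
  set K : Set Plane := closedBall (0 : Plane) s ∩ v ⁻¹' Set.Ici k with hK
  have hKclosed : IsClosed K :=
    (hv.continuousOn.mono hsub).preimage_isClosed_of_isClosed isClosed_closedBall isClosed_Ici
  have hKcompact : IsCompact K :=
    (isCompact_closedBall (0 : Plane) s).of_isClosed_subset hKclosed Set.inter_subset_left
  have hKball : K ⊆ ball (0 : Plane) s := by
    rintro x ⟨hx, hkx⟩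
    rw [mem_closedBall_zero_iff] at hx
    rw [mem_ball_zero_iff]
    exact lt_of_le_of_ne hx fun h => absurd (hk x h) (not_lt.mpr hkx)
  have hzero : ∀ x ∉ K, φ x = 0 := by
    intro x hx
    by_cases hxs : x ∈ ball (0 : Plane) s
    · have : v x < k := by
        by_contra! h
        exact hx ⟨ball_subset_closedBall hxs, h⟩
      simp [hφ, hxs, max_eq_right (sub_neg.mpr this).le]
    · simp [hφ, hxs]
  have htsupp : tsupport φ ⊆ K :=
    closure_minimal (fun x hx => by by_contra h; exact hx (hzero x h)) hKclosed
  have heq : ∀ x ∈ ball (0 : Plane) s, φ =ᶠ[nhds x] fun x => max (v x - k) 0 ^ 2 := by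
    intro x hx
    filter_upwards [isOpen_ball.mem_nhds hx] with y hy
    simp [hφ, hy]
  have hcd : ContDiff ℝ 1 φ := by
    rw [contDiff_iff_contDiffAt]
    intro x
    by_cases hx : x ∈ ball (0 : Plane) s
    · refine ContDiffAt.congr_of_eventuallyEq ?_ (heq x hx)
      exact contDiff_sq_max_zero.contDiffAt.comp x
        ((hv.contDiffAt_of_mem_ball (hsub' hx)).sub contDiffAt_const)
    · refine (contDiffAt_const (c := (0 : ℝ))).congr_of_eventuallyEq ?_
      filter_upwards [hKclosed.isOpen_compl.mem_nhds fun h => hx (hKball h)] with y hy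
      exact hzero y hy
  have hcs : HasCompactSupport φ := HasCompactSupport.intro hKcompact hzero
  have hts : tsupport φ ⊆ ball (0 : Plane) 1 := htsupp.trans (hKball.trans hsub')
  have hfd : ∀ x ∈ ball (0 : Plane) s, fderiv ℝ φ x = (2 * max (v x - k) 0) • fderiv ℝ v x := by
    intro x hx
    rw [(heq x hx).fderiv_eq]
    exact ((hasDerivAt_sq_max_zero (v x - k)).comp_hasFDerivAt x
      ((hv.hasFDerivAt_of_mem_ball (hsub' hx)).sub_const k)).fderiv
  have hfd0 : ∀ x ∉ ball (0 : Plane) s, fderiv ℝ φ x = 0 := by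
    intro x hx
    by_contra h
    exact hx (hKball (htsupp (support_fderiv_subset ℝ h)))
  have hpair : ∀ x ∈ ball (0 : Plane) s, pairing (a x) (gradient φ x) (gradient v x) =
      2 * max (v x - k) 0 * pairing (a x) (gradient v x) (gradient v x) := by
    intro x hx
    rw [← pairing_smul_left]
    simp [gradient, hfd x hx]
  have hae := (setIntegral_eq_zero_iff_of_nonneg_ae ?_
    (hv.integrableOn_pairing hlam ham ha hcd hcs hts)).mp (isWeakSolution_iff.mp hw φ hcd hcs hts)
  · have hcont : ContinuousOn (fun x => max (v x - k) 0 * ‖gradient v x‖ ^ 2) (ball (0 : Plane) s) := by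
      have h1 := hv.continuousOn.mono hsub'
      have h2 := hv.continuousOn_gradient.mono hsub'
      fun_prop
    have hvanish := Measure.eqOn_open_of_ae_eq (μ := (volume : Measure Plane))
      (f := fun x => max (v x - k) 0 * ‖gradient v x‖ ^ 2) (g := fun _ => 0) ?_ isOpen_ball hcont
      continuousOn_const
    · have hfdz (x : Plane) : fderiv ℝ φ x = 0 := by
        by_cases hx : x ∈ ball (0 : Plane) s
        · rw [hfd x hx]
          rcases mul_eq_zero.mp (hvanish hx) with h | h
          · simp [h]
          · have : gradient v x = 0 := by simpa using h
            rw [gradient, map_eq_zero_iff _ (LinearIsometryEquiv.injective _)] at this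
            simp [this]
        · exact hfd0 x hx
      have h1 : φ x₀ = 0 := by
        obtain ⟨y, hy⟩ : ∃ y : Plane, y ∉ ball (0 : Plane) s := by
          obtain ⟨y, hy⟩ := NormedSpace.exists_lt_norm ℝ Plane s
          exact ⟨y, by simpa using hy.le⟩
        rw [is_const_of_fderiv_eq_zero (hcd.differentiable one_ne_zero) hfdz x₀ y]
        simp [hφ, hy]
      have h2 : 0 < φ x₀ := by
        rw [hφ, Set.indicator_of_mem hx₀, max_eq_left (sub_pos.mpr hlt).le]
        exact pow_pos (sub_pos.mpr hlt) 2
      exact h2.ne' h1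
    · have hae' := ae_restrict_of_ae_restrict_of_subset hsub' hae
      filter_upwards [hae', ae_restrict_mem measurableSet_ball] with x hx hxs
      rw [hpair x hxs, Pi.zero_apply] at hx
      have h1 := ha.lower (hsub' hxs) (gradient v x)
      have h2 : 0 ≤ max (v x - k) 0 := le_max_right _ _
      have h3 : 0 ≤ max (v x - k) 0 * ‖gradient v x‖ ^ 2 := by positivity
      have h4 := mul_le_mul_of_nonneg_left h1 h2
      have h5 : lam * (max (v x - k) 0 * ‖gradient v x‖ ^ 2) ≤ lam * 0 := by linarith
      exact le_antisymm (le_of_mul_le_mul_left h5 hlam) h3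
  · filter_upwards [ae_restrict_mem measurableSet_ball] with x hx
    by_cases hxs : x ∈ ball (0 : Plane) s
    · rw [hpair x hxs]
      have h1 := ha.lower hx (gradient v x)
      have h2 : 0 ≤ max (v x - k) 0 := le_max_right _ _
      have h3 : 0 ≤ lam * ‖gradient v x‖ ^ 2 := by positivity
      exact mul_nonneg (by positivity) (h3.trans h1)
    · simp [gradient, hfd0 x hxs]

/-- Values inside a disc are dominated by some value on its boundary circle. -/
theorem exists_norm_eq_le {s : ℝ} (hs : s < 1) {x₀ : Plane} (hx₀ : x₀ ∈ ball (0 : Plane) s) :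
    ∃ p : Plane, ‖p‖ = s ∧ v x₀ ≤ v p := by
  have hs0 : 0 ≤ s := (pos_of_mem_ball hx₀).le
  have hsub : sphere (0 : Plane) s ⊆ ball 0 1 :=
    sphere_subset_closedBall.trans (closedBall_subset_ball hs)
  obtain ⟨p, hp, hmax⟩ := (isCompact_sphere (0 : Plane) s).exists_isMaxOn
    (NormedSpace.sphere_nonempty.mpr hs0) (hv.continuousOn.mono hsub)
  refine ⟨p, by simpa using hp, ?_⟩
  by_contra! hlt
  obtain ⟨k, hk1, hk2⟩ := exists_between hlt
  refine absurd (le_of_forall_norm_eq_lt hlam ham ha hv hw hs (k := k) (fun q hq => ?_) hx₀)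
    (not_le.mpr hk2)
  exact lt_of_le_of_lt (hmax (by simpa using hq)) hk1

/-- Caccioppoli's inequality, with the explicit cutoff `(1 - |x|² / R²)₊`. -/
theorem lintegral_gradient_sq_le {R m ω : ℝ} (hR : 0 < R) (hR1 : R < 1)
    (hosc : ∀ x ∈ ball (0 : Plane) R, |v x - m| ≤ ω) :
    ∫⁻ x in ball (0 : Plane) (R / 2), ENNReal.ofReal (‖gradient v x‖ ^ 2) ≤
      ENNReal.ofReal (32 * Real.pi * ω ^ 2 / lam ^ 2) := by
  set η : Plane → ℝ := fun x => max (1 - ‖x‖ ^ 2 / R ^ 2) 0 with hη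
  set φ : Plane → ℝ := fun x => η x ^ 2 * (v x - m) with hφ
  have hsub : closedBall (0 : Plane) R ⊆ ball 0 1 := closedBall_subset_ball hR1
  have hsub' : ball (0 : Plane) R ⊆ ball 0 1 := ball_subset_ball hR1.le
  have hη0 : ∀ x ∉ ball (0 : Plane) R, η x = 0 := by
    intro x hx
    have hx : R ≤ ‖x‖ := by simpa using hx
    refine max_eq_right (sub_nonpos.mpr ?_)
    rw [one_le_div (by positivity)]
    gcongr
  have hzero : ∀ x ∉ closedBall (0 : Plane) R, φ x = 0 := fun x hx => by
    simp [hφ, hη0 x fun h => hx (ball_subset_closedBall h)]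
  have htsupp : tsupport φ ⊆ closedBall (0 : Plane) R :=
    closure_minimal (fun x hx => by by_contra h; exact hx (hzero x h)) isClosed_closedBall
  have hcs : HasCompactSupport φ := HasCompactSupport.intro (isCompact_closedBall (0 : Plane) R) hzero
  have hts : tsupport φ ⊆ ball (0 : Plane) 1 := htsupp.trans hsub
  have hη2 : ContDiff ℝ 1 fun x => η x ^ 2 :=
    contDiff_sq_max_zero.comp (contDiff_const.sub ((contDiff_norm_sq ℝ).div_const _))
  have hcd : ContDiff ℝ 1 φ := by
    rw [contDiff_iff_contDiffAt]
    intro x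
    by_cases hx : x ∈ ball (0 : Plane) 1
    · exact hη2.contDiffAt.mul ((hv.contDiffAt_of_mem_ball hx).sub contDiffAt_const)
    · refine (contDiffAt_const (c := (0 : ℝ))).congr_of_eventuallyEq ?_
      filter_upwards [isClosed_closedBall.isOpen_compl.mem_nhds fun h => hx (hsub h)] with y hy
      exact hzero y hy
  have hgrad : ∀ x ∈ ball (0 : Plane) 1, gradient φ x =
      η x ^ 2 • gradient v x + (-(4 / R ^ 2) * η x * (v x - m)) • x := by
    intro x hx
    have h1 : HasFDerivAt (fun y : Plane => 1 - ‖y‖ ^ 2 / R ^ 2)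
        (-((R ^ 2)⁻¹ • (2 • innerSL ℝ x))) x := by
      simpa [div_eq_mul_inv] using
        (((hasStrictFDerivAt_norm_sq x).hasFDerivAt.mul_const ((R ^ 2)⁻¹)).const_sub 1)
    have h2 := (hasDerivAt_sq_max_zero (1 - ‖x‖ ^ 2 / R ^ 2)).comp_hasFDerivAt x h1
    have h3 := h2.mul ((hv.hasFDerivAt_of_mem_ball hx).sub_const m)
    have h4 : HasGradientAt φ _ x := h3.hasGradientAt
    rw [h4.gradient]
    have h5 : (InnerProductSpace.toDual ℝ Plane).symm (innerSL ℝ x) = x :=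
      (InnerProductSpace.toDual ℝ Plane).symm_apply_apply x
    simp only [map_add, map_smul, map_neg, map_nsmul, h5, gradient, Function.comp]
    simp only [hη]
    module
  have hpair0 : ∀ x ∈ ball (0 : Plane) 1, x ∉ ball (0 : Plane) R →
      pairing (a x) (gradient φ x) (gradient v x) = 0 := by
    intro x hx hxR
    simp [hgrad x hx, hη0 x hxR]
  have hpair : ∀ x ∈ ball (0 : Plane) R,
      1 / 2 * lam * (η x ^ 2 * ‖gradient v x‖ ^ 2) - 8 / R ^ 2 * lam⁻¹ * ω ^ 2 ≤
        pairing (a x) (gradient φ x) (gradient v x) := by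
    intro x hx
    have hx1 := hsub' hx
    have hxR : ‖x‖ ≤ R := by simpa using (mem_ball_zero_iff.mp hx).le
    have hy := ha.young hlam hx1 ((4 / R ^ 2 * (v x - m)) • x) (η x • gradient v x)
    have hl := mul_le_mul_of_nonneg_left (ha.lower hx1 (gradient v x)) (sq_nonneg (η x))
    have hu := mul_le_mul_of_nonneg_left (ha.upper hx1 x)
      (by positivity : 0 ≤ 8 / R ^ 4 * (v x - m) ^ 2)
    have hb : 8 / R ^ 4 * (v x - m) ^ 2 * (lam⁻¹ * ‖x‖ ^ 2) ≤
        8 / R ^ 4 * ω ^ 2 * (lam⁻¹ * R ^ 2) := by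
      have h2 : (v x - m) ^ 2 ≤ ω ^ 2 := sq_le_sq' (abs_le.mp (hosc x hx)).1 (abs_le.mp (hosc x hx)).2
      gcongr
    have hb' : 8 / R ^ 4 * ω ^ 2 * (lam⁻¹ * R ^ 2) = 8 / R ^ 2 * lam⁻¹ * ω ^ 2 := by
      field_simp
    simp only [pairing_smul_left, pairing_smul_right] at hy
    rw [hgrad x hx1, pairing_add_left, pairing_smul_left, pairing_smul_left]
    have e1 : 1 / 2 * (4 / R ^ 2 * (v x - m) * (4 / R ^ 2 * (v x - m) * pairing (a x) x x)) =
        8 / R ^ 4 * (v x - m) ^ 2 * pairing (a x) x x := by field_simp; ring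
    rw [e1] at hy
    linarith
  have hpair_int := hv.integrableOn_pairing hlam ham ha hcd hcs hts
  have hI : ∫ x in ball (0 : Plane) R, pairing (a x) (gradient φ x) (gradient v x) = 0 := by
    rw [← isWeakSolution_iff.mp hw φ hcd hcs hts]
    exact (setIntegral_eq_of_subset_of_forall_sdiff_eq_zero measurableSet_ball hsub'
      fun x hx => hpair0 x hx.1 hx.2).symm
  have hpairR_int := hpair_int.mono_set hsub'
  have hpt : ∀ x ∈ ball (0 : Plane) R,
      (ball (0 : Plane) (R / 2)).indicator (fun x => ‖gradient v x‖ ^ 2) x ≤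
        4 / lam * pairing (a x) (gradient φ x) (gradient v x) + 32 * ω ^ 2 / (lam ^ 2 * R ^ 2) := by
    intro x hx
    have h1 : (ball (0 : Plane) (R / 2)).indicator (fun x => ‖gradient v x‖ ^ 2) x ≤
        2 * (η x ^ 2 * ‖gradient v x‖ ^ 2) := by
      by_cases hxR : x ∈ ball (0 : Plane) (R / 2)
      · rw [Set.indicator_of_mem hxR]
        have h2 : 3 / 4 ≤ η x := by
          refine le_max_of_le_left ?_
          have h3 : ‖x‖ ≤ R / 2 := by simpa using (mem_ball_zero_iff.mp hxR).le
          have h4 : ‖x‖ ^ 2 / R ^ 2 ≤ (R / 2) ^ 2 / R ^ 2 := by gcongr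
          have h5 : (R / 2) ^ 2 / R ^ 2 = 1 / 4 := by field_simp; norm_num
          linarith
        have h6 : 1 / 2 ≤ η x ^ 2 := by nlinarith
        nlinarith [sq_nonneg ‖gradient v x‖]
      · rw [Set.indicator_of_notMem hxR]
        positivity
    have h7 := mul_le_mul_of_nonneg_left (hpair x hx) (by positivity : 0 ≤ 4 / lam)
    have h8 : 4 / lam * (1 / 2 * lam * (η x ^ 2 * ‖gradient v x‖ ^ 2) - 8 / R ^ 2 * lam⁻¹ * ω ^ 2) =
        2 * (η x ^ 2 * ‖gradient v x‖ ^ 2) - 32 * ω ^ 2 / (lam ^ 2 * R ^ 2) := by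
      field_simp
      ring
    linarith
  have hrhs : IntegrableOn (fun x => 4 / lam * pairing (a x) (gradient φ x) (gradient v x) +
      32 * ω ^ 2 / (lam ^ 2 * R ^ 2)) (ball (0 : Plane) R) :=
    (hpairR_int.const_mul _).add (integrableOn_const measure_ball_lt_top.ne)
  calc ∫⁻ x in ball (0 : Plane) (R / 2), ENNReal.ofReal (‖gradient v x‖ ^ 2)
      = ∫⁻ x in ball (0 : Plane) R, ENNReal.ofReal
          ((ball (0 : Plane) (R / 2)).indicator (fun x => ‖gradient v x‖ ^ 2) x) := by
        have h1 : ball (0 : Plane) (R / 2) ∩ ball 0 R = ball (0 : Plane) (R / 2) :=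
          Set.inter_eq_left.mpr (ball_subset_ball (by linarith))
        rw [← h1, ← Measure.restrict_restrict measurableSet_ball,
          ← lintegral_indicator measurableSet_ball, h1]
        congr 1 with x
        by_cases hx : x ∈ ball (0 : Plane) (R / 2)
        · rw [Set.indicator_of_mem hx, Set.indicator_of_mem hx]
        · rw [Set.indicator_of_notMem hx, Set.indicator_of_notMem hx, ENNReal.ofReal_zero]
    _ ≤ ∫⁻ x in ball (0 : Plane) R, ENNReal.ofReal
          (4 / lam * pairing (a x) (gradient φ x) (gradient v x) +
            32 * ω ^ 2 / (lam ^ 2 * R ^ 2)) :=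
        setLIntegral_mono' measurableSet_ball fun x hx => ENNReal.ofReal_le_ofReal (hpt x hx)
    _ = ENNReal.ofReal (∫ x in ball (0 : Plane) R,
          (4 / lam * pairing (a x) (gradient φ x) (gradient v x) +
            32 * ω ^ 2 / (lam ^ 2 * R ^ 2))) := by
        rw [ofReal_integral_eq_lintegral_ofReal hrhs]
        filter_upwards [ae_restrict_mem measurableSet_ball] with x hx
        exact le_trans (Set.indicator_nonneg (fun _ _ => by positivity) x) (hpt x hx)
    _ = ENNReal.ofReal (32 * Real.pi * ω ^ 2 / lam ^ 2) := by
        congr 1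
        rw [integral_add (hpairR_int.const_mul _) (integrableOn_const measure_ball_lt_top.ne),
          integral_const_mul, hI, setIntegral_const, measureReal_def,
          EuclideanSpace.volume_ball_fin_two]
        simp [ENNReal.toReal_ofReal hR.le, ENNReal.toReal_ofReal Real.pi_pos.le]
        field_simp

end WeakSolution

/-- The point of the plane with polar coordinates `(s, θ)`. -/
def polarPoint (s θ : ℝ) : Plane :=
  WithLp.toLp 2 ![s * Real.cos θ, s * Real.sin θ]

theorem norm_polarPoint {s : ℝ} (hs : 0 ≤ s) (θ : ℝ) : ‖polarPoint s θ‖ = s := by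
  rw [EuclideanSpace.norm_eq, Real.sqrt_eq_iff_mul_self_eq (by positivity) hs]
  simp [polarPoint, Fin.sum_univ_two]
  linear_combination (s ^ 2) * Real.sin_sq_add_cos_sq θ

theorem hasDerivAt_polarPoint (s θ : ℝ) :
    HasDerivAt (polarPoint s) (polarPoint s (θ + Real.pi / 2)) θ := by
  refine (PiLp.continuousLinearEquiv 2 ℝ fun _ : Fin 2 => ℝ).symm.hasFDerivAt.comp_hasDerivAt θ
    (hasDerivAt_pi.mpr fun i => ?_)
  fin_cases i
  · simpa [polarPoint, Real.cos_add_pi_div_two] using (Real.hasDerivAt_cos θ).const_mul s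
  · simpa [polarPoint, Real.sin_add_pi_div_two] using (Real.hasDerivAt_sin θ).const_mul s

theorem exists_polarPoint_eq (p : Plane) :
    ∃ θ ∈ Set.Icc (-Real.pi) Real.pi, p = polarPoint ‖p‖ θ := by
  set z : ℂ := ⟨p 0, p 1⟩ with hz
  have hn : ‖z‖ = ‖p‖ := by
    rw [EuclideanSpace.norm_eq, Complex.norm_eq_sqrt_sq_add_sq]
    simp [hz, Fin.sum_univ_two]
  refine ⟨z.arg, ⟨(Complex.neg_pi_lt_arg z).le, Complex.arg_le_pi z⟩, ?_⟩
  ext i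
  fin_cases i
  · simp [polarPoint, ← hn, Complex.norm_mul_cos_arg, hz]
  · simp [polarPoint, ← hn, Complex.norm_mul_sin_arg, hz]

/-- Nonnegative integrals over the plane in polar coordinates. -/
theorem lintegral_polarPoint (f : Plane → ENNReal) (hf : Measurable f) :
    ∫⁻ s in Set.Ioi (0 : ℝ), ∫⁻ θ in Set.Ioo (-Real.pi) Real.pi,
      ENNReal.ofReal s * f (polarPoint s θ) = ∫⁻ x, f x := by
  have h1 := (EuclideanSpace.volume_preserving_symm_measurableEquiv_toLp (Fin 2)).trans
    (volume_preserving_finTwoArrow ℝ)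
  set e : Plane ≃ᵐ ℝ × ℝ :=
    (MeasurableEquiv.toLp 2 (Fin 2 → ℝ)).symm.trans MeasurableEquiv.finTwoArrow with he
  have h2 : MeasurePreserving e volume volume := h1
  have h3 (s θ : ℝ) : e.symm (polarCoord.symm (s, θ)) = polarPoint s θ := by
    rfl
  rw [← h2.symm.lintegral_comp_emb e.symm.measurableEmbedding f, ← lintegral_comp_polarCoord_symm,
    polarCoord_target, Measure.volume_eq_prod, ← Measure.prod_restrict, lintegral_prod]
  · simp only [h3, smul_eq_mul]
  · refine Measurable.aemeasurable ?_
    have h4 : Measurable (polarCoord.symm : ℝ × ℝ → ℝ × ℝ) := by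
      refine Continuous.measurable ?_
      exact continuous_polarCoord_symm
    have h5 := hf.comp (e.symm.measurable.comp h4)
    exact (ENNReal.measurable_ofReal.comp measurable_fst).smul h5

section CourantLebesgue

variable {v : Plane → ℝ} (hv : ContDiffOn ℝ 1 v (ball (0 : Plane) 1))
include hv

theorem hasDerivAt_comp_polarPoint {s : ℝ} (hs0 : 0 ≤ s) (hs : s < 1) (θ : ℝ) :
    HasDerivAt (fun θ => v (polarPoint s θ))
      (fderiv ℝ v (polarPoint s θ) (polarPoint s (θ + Real.pi / 2))) θ := by
  have h := hv.hasFDerivAt_of_mem_ball (x := polarPoint s θ)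
    (by simpa [norm_polarPoint hs0] using hs)
  exact h.comp_hasDerivAt θ (hasDerivAt_polarPoint s θ)

theorem continuous_gradient_polarPoint {s : ℝ} (hs0 : 0 ≤ s) (hs : s < 1) :
    Continuous fun θ => gradient v (polarPoint s θ) := by
  have hc : Continuous (polarPoint s) :=
    continuous_iff_continuousAt.mpr fun θ => (hasDerivAt_polarPoint s θ).continuousAt
  exact hv.continuousOn_gradient.comp_continuous hc
    fun θ => by simpa [norm_polarPoint hs0] using hs

/-- A lower bound for the energy of `v` on a circle in terms of its oscillation there. -/
theorem sq_div_le_integral_circle {s κ : ℝ} (hs0 : 0 < s) (hs : s < 1) (hκ : 0 < κ) {p q : Plane}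
    (hp : ‖p‖ = s) (hq : ‖q‖ = s) (hpq : κ ≤ v p - v q) :
    κ ^ 2 / (2 * Real.pi) ≤
      s ^ 2 * ∫ θ in Set.Ioo (-Real.pi) Real.pi, ‖gradient v (polarPoint s θ)‖ ^ 2 := by
  have hpi := Real.pi_pos
  obtain ⟨θ₁, h₁, e₁⟩ := exists_polarPoint_eq p
  obtain ⟨θ₂, h₂, e₂⟩ := exists_polarPoint_eq q
  rw [hp] at e₁
  rw [hq] at e₂
  set g : ℝ → ℝ := fun θ => s * ‖gradient v (polarPoint s θ)‖ with hg
  have hgc : Continuous g := (continuous_gradient_polarPoint hv hs0.le hs).norm.const_mul s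
  have hd := hasDerivAt_comp_polarPoint hv hs0.le hs
  have hdb (θ : ℝ) : ‖fderiv ℝ v (polarPoint s θ) (polarPoint s (θ + Real.pi / 2))‖ ≤ g θ := by
    refine (ContinuousLinearMap.le_opNorm _ _).trans_eq ?_
    rw [norm_polarPoint hs0.le, mul_comm]
    exact congrArg (s * ·) (LinearIsometryEquiv.norm_map _ _).symm
  have hdiff : κ ≤ ∫ θ in Set.Ioo (-Real.pi) Real.pi, g θ := by
    have hmono : ∀ α ∈ Set.Icc (-Real.pi) Real.pi, ∀ β ∈ Set.Icc (-Real.pi) Real.pi, α ≤ β →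
        ‖v (polarPoint s β) - v (polarPoint s α)‖ ≤ ∫ θ in Set.Ioo (-Real.pi) Real.pi, g θ := by
      intro α hα β hβ hαβ
      refine (norm_sub_le_integral_of_norm_deriv_le_of_le hαβ
        (fun θ _ => (hd θ).continuousAt.continuousWithinAt)
        (fun θ _ => (hd θ).differentiableAt.differentiableWithinAt)
        (Filter.Eventually.of_forall fun θ _ => (hd θ).deriv ▸ hdb θ)
        (hgc.intervalIntegrable α β)).trans ?_
      rw [intervalIntegral.integral_of_le hαβ, ← integral_Ioc_eq_integral_Ioo]
      exact setIntegral_mono_set (hgc.integrableOn_Icc.mono_set Set.Ioc_subset_Icc_self)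
        (Filter.Eventually.of_forall fun θ => by positivity)
        (Set.Ioc_subset_Ioc hα.1 hβ.2).eventuallyLE
    refine hpq.trans ((le_abs_self _).trans ?_)
    rw [← Real.norm_eq_abs, e₁, e₂]
    rcases le_total θ₂ θ₁ with h | h
    · exact hmono θ₂ h₂ θ₁ h₁ h
    · rw [norm_sub_rev]
      exact hmono θ₁ h₁ θ₂ h₂ h
  have hyoung : ∫ θ in Set.Ioo (-Real.pi) Real.pi, g θ ≤
      ∫ θ in Set.Ioo (-Real.pi) Real.pi, (Real.pi / κ * g θ ^ 2 + κ / (4 * Real.pi)) := by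
    refine integral_mono (hgc.integrableOn_Icc.mono_set Set.Ioo_subset_Icc_self)
      (Continuous.integrableOn_Icc (by fun_prop) |>.mono_set Set.Ioo_subset_Icc_self) fun θ => ?_
    have h0 : Real.pi / κ * g θ ^ 2 + κ / (4 * Real.pi) - g θ =
        Real.pi / κ * (g θ - κ / (2 * Real.pi)) ^ 2 := by
      field_simp
      ring
    have h4 : 0 ≤ Real.pi / κ * (g θ - κ / (2 * Real.pi)) ^ 2 := by positivity
    simp only
    linarith
  have hsum : ∫ θ in Set.Ioo (-Real.pi) Real.pi, (Real.pi / κ * g θ ^ 2 + κ / (4 * Real.pi)) =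
      Real.pi / κ * (s ^ 2 * ∫ θ in Set.Ioo (-Real.pi) Real.pi,
        ‖gradient v (polarPoint s θ)‖ ^ 2) + κ / 2 := by
    have hi : IntegrableOn (fun θ => Real.pi / κ * g θ ^ 2) (Set.Ioo (-Real.pi) Real.pi) :=
      (Continuous.integrableOn_Icc (by fun_prop)).mono_set Set.Ioo_subset_Icc_self
    rw [integral_add hi (integrable_const _), integral_const_mul, setIntegral_const]
    simp only [hg, mul_pow, integral_const_mul]
    rw [Real.volume_real_Ioo_of_le (by linarith), smul_eq_mul]
    field_simp
    ring
  have hfin := hdiff.trans (hyoung.trans_eq hsum)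
  rw [div_le_iff₀ (by positivity)]
  set J := s ^ 2 * ∫ θ in Set.Ioo (-Real.pi) Real.pi, ‖gradient v (polarPoint s θ)‖ ^ 2
  have h5 : κ * (κ / 2) ≤ κ * (Real.pi / κ * J) := by gcongr; linarith
  have h6 : κ * (Real.pi / κ * J) = Real.pi * J := by field_simp
  linarith

/-- The Courant–Lebesgue lower bound for the Dirichlet energy. -/
theorem log_le_lintegral_gradient_sq {α β κ : ℝ} (hα : 0 < α) (hαβ : α < β) (hβ : β ≤ 1)
    (hκ : 0 < κ)
    (h : ∀ s ∈ Set.Ioo α β, ∃ p q : Plane, ‖p‖ = s ∧ ‖q‖ = s ∧ κ ≤ v p - v q) :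
    ENNReal.ofReal (κ ^ 2 / (2 * Real.pi) * Real.log (β / α)) ≤
      ∫⁻ x in ball (0 : Plane) β, ENNReal.ofReal (‖gradient v x‖ ^ 2) := by
  have hmeas : Measurable fun x => ENNReal.ofReal (‖gradient v x‖ ^ 2) :=
    ((measurable_gradient v).norm.pow_const 2).ennreal_ofReal
  have hinv : IntegrableOn (fun s : ℝ => κ ^ 2 / (2 * Real.pi) * (1 / s)) (Set.Ioc α β) := by
    refine IntegrableOn.mono_set (ContinuousOn.integrableOn_Icc ?_) Set.Ioc_subset_Icc_self
    refine continuousOn_const.mul (continuousOn_const.div continuousOn_id fun s hs => ?_)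
    exact (hα.trans_le hs.1).ne'
  rw [← lintegral_indicator measurableSet_ball,
    ← lintegral_polarPoint _ (hmeas.indicator measurableSet_ball)]
  calc ENNReal.ofReal (κ ^ 2 / (2 * Real.pi) * Real.log (β / α))
      = ∫⁻ s in Set.Ioo α β, ENNReal.ofReal (κ ^ 2 / (2 * Real.pi) * (1 / s)) := by
        rw [← integral_one_div_of_pos hα (hα.trans hαβ), ← intervalIntegral.integral_const_mul,
          intervalIntegral.integral_of_le hαβ.le, ofReal_integral_eq_lintegral_ofReal hinv,
          restrict_Ioo_eq_restrict_Ioc]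
        filter_upwards [ae_restrict_mem measurableSet_Ioc] with s hs
        have := hα.trans hs.1
        positivity
    _ ≤ ∫⁻ s in Set.Ioo α β, ∫⁻ θ in Set.Ioo (-Real.pi) Real.pi, ENNReal.ofReal s *
          (ball (0 : Plane) β).indicator (fun x => ENNReal.ofReal (‖gradient v x‖ ^ 2))
            (polarPoint s θ) := by
        refine setLIntegral_mono' measurableSet_Ioo fun s hs => ?_
        obtain ⟨p, q, hp, hq, hpq⟩ := h s hs
        have hs0 : 0 < s := hα.trans hs.1
        have hs1 : s < 1 := hs.2.trans_le hβ
        have hmem (θ : ℝ) : polarPoint s θ ∈ ball (0 : Plane) β := by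
          simpa [norm_polarPoint hs0.le] using hs.2
        have hci : IntegrableOn (fun θ => s * ‖gradient v (polarPoint s θ)‖ ^ 2)
            (Set.Ioo (-Real.pi) Real.pi) :=
          (Continuous.integrableOn_Icc (((continuous_gradient_polarPoint hv hs0.le hs1).norm.pow
            2).const_mul s)).mono_set Set.Ioo_subset_Icc_self
        simp only [Set.indicator_of_mem (hmem _), ← ENNReal.ofReal_mul hs0.le]
        rw [← ofReal_integral_eq_lintegral_ofReal hci
          (Filter.Eventually.of_forall fun θ => by positivity), integral_const_mul]
        refine ENNReal.ofReal_le_ofReal ?_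
        have h1 := sq_div_le_integral_circle hv hs0 hs1 hκ hp hq hpq
        rw [mul_one_div, div_le_iff₀ hs0]
        linarith
    _ ≤ _ := lintegral_mono_set fun s hs => hα.trans hs.1

end CourantLebesgue

/-- Two-dimensional oscillation decay for weak solutions of uniformly elliptic equations. -/
theorem two_dim_oscillation_decay (lam : ℝ) (hlam : lam ∈ Set.Ioc (0 : ℝ) 1) :
    ∃ δ ∈ Set.Ioo (0 : ℝ) 1,
      ∀ a : EuclideanSpace ℝ (Fin 2) → Matrix (Fin 2) (Fin 2) ℝ,
        (∀ i j, Measurable fun x => a x i j) →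
        UniformlyElliptic lam (ball (0 : EuclideanSpace ℝ (Fin 2)) 1) a →
        ∀ v : EuclideanSpace ℝ (Fin 2) → ℝ,
          ContDiffOn ℝ 1 v (ball (0 : EuclideanSpace ℝ (Fin 2)) 1) →
          (∃ M : ℝ, ∀ x ∈ ball (0 : EuclideanSpace ℝ (Fin 2)) 1, |v x| ≤ M) →
          IsWeakSolution (ball (0 : EuclideanSpace ℝ (Fin 2)) 1) a v →
          ∀ r : ℝ, r ∈ Set.Ioc (0 : ℝ) 1 →
            osc v (ball (0 : EuclideanSpace ℝ (Fin 2)) (δ * r)) ≤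
              (1 / 2) * osc v (ball (0 : EuclideanSpace ℝ (Fin 2)) r) := by
  obtain ⟨hlam0, -⟩ := hlam
  have hpi := Real.pi_pos
  set T : ℝ := 256 * Real.pi ^ 2 / lam ^ 2 + 1 with hT
  have hT0 : 0 < T := by positivity
  have hexp : Real.exp (-T) < 1 := by
    simpa using hT0
  have hexp0 := Real.exp_pos (-T)
  refine ⟨Real.exp (-T) / 4, ⟨by positivity, by linarith⟩, ?_⟩
  rintro a ham ha v hv ⟨M, hM⟩ hw r ⟨hr0, hr1⟩
  set δ : ℝ := Real.exp (-T) / 4 with hδ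
  have hδ0 : 0 < δ := by positivity
  have hδ4 : δ < 1 / 4 := by linarith
  have hsub : ball (0 : Plane) r ⊆ ball 0 1 := ball_subset_ball hr1
  have hδr : δ * r < r / 4 := by nlinarith
  have hδr0 : 0 < δ * r := by positivity
  have hbdd : BddAbove (v '' ball (0 : Plane) r) := by
    refine ⟨M, ?_⟩
    rintro _ ⟨x, hx, rfl⟩
    exact (abs_le.mp (hM x (hsub hx))).2
  have hbdd' : BddBelow (v '' ball (0 : Plane) r) := by
    refine ⟨-M, ?_⟩
    rintro _ ⟨x, hx, rfl⟩
    exact (abs_le.mp (hM x (hsub hx))).1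
  set ω : ℝ := osc v (ball (0 : Plane) r) with hω
  have hosc : ∀ x ∈ ball (0 : Plane) r, ∀ y ∈ ball (0 : Plane) r, v x - v y ≤ ω := by
    intro x hx y hy
    exact sub_le_sub (le_csSup hbdd (Set.mem_image_of_mem v hx))
      (csInf_le hbdd' (Set.mem_image_of_mem v hy))
  have hne : (v '' ball (0 : Plane) (δ * r)).Nonempty := (nonempty_ball.mpr hδr0).image v
  by_contra! hlt
  obtain ⟨x, hx, y, hy, hxy⟩ : ∃ x ∈ ball (0 : Plane) (δ * r), ∃ y ∈ ball (0 : Plane) (δ * r),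
      1 / 2 * ω < v x - v y := by
    by_contra! hall
    refine absurd hlt (not_lt.mpr ?_)
    rw [osc, sub_le_iff_le_add]
    refine csSup_le hne ?_
    rintro _ ⟨x, hx, rfl⟩
    rw [← sub_le_iff_le_add']
    refine le_csInf hne ?_
    rintro _ ⟨y, hy, rfl⟩
    linarith [hall x hx y hy]
  have hsubδ : ball (0 : Plane) (δ * r) ⊆ ball 0 r := ball_subset_ball (by linarith)
  have hω0 : 0 < ω := by linarith [hosc x (hsubδ hx) y (hsubδ hy)]
  have hupper := lintegral_gradient_sq_le hlam0 ham ha hv hw (R := r / 2) (m := v 0) (ω := ω)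
    (by positivity) (by linarith) (fun z hz => by
      have hz' : z ∈ ball (0 : Plane) r := ball_subset_ball (by linarith) hz
      have h0 : (0 : Plane) ∈ ball (0 : Plane) r := mem_ball_self hr0
      rw [abs_le]
      exact ⟨by linarith [hosc 0 h0 z hz'], hosc z hz' 0 h0⟩)
  have hlower := log_le_lintegral_gradient_sq hv (α := δ * r) (β := r / 2 / 2) (κ := 1 / 2 * ω)
    hδr0 (by linarith) (by linarith) (by positivity) (fun s hs => by
      have hs1 : s < 1 := by linarith [hs.2]
      have hss : ball (0 : Plane) (δ * r) ⊆ ball 0 s := ball_subset_ball hs.1.le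
      obtain ⟨p, hp, hvp⟩ := exists_norm_eq_le hlam0 ham ha hv hw hs1 (hss hx)
      obtain ⟨q, hq, hvq⟩ := exists_norm_eq_le hlam0 ham ha hv.neg hw.neg hs1 (hss hy)
      exact ⟨p, q, hp, hq, by linarith⟩)
  have hcomp := hlower.trans hupper
  rw [ENNReal.ofReal_le_ofReal_iff (by positivity)] at hcomp
  have hlog : Real.log (r / 2 / 2 / (δ * r)) = T := by
    have : r / 2 / 2 / (δ * r) = Real.exp T := by
      rw [hδ, Real.exp_neg]
      field_simp
      norm_num
    rw [this, Real.log_exp]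
  rw [hlog, hT] at hcomp
  have h1 : (1 / 2 * ω) ^ 2 / (2 * Real.pi) * (256 * Real.pi ^ 2 / lam ^ 2 + 1) =
      32 * Real.pi * ω ^ 2 / lam ^ 2 + ω ^ 2 / (8 * Real.pi) := by
    field_simp
    ring
  have h2 : 0 < ω ^ 2 / (8 * Real.pi) := by positivity
  linarith
end
end

section
/- (Subharmonicity of almost-convex functions of the gradient of a harmonic function) Let n ≥ 2, let Ω ⊂ ℝⁿ be open, let u be a smooth harmonic function on Ω (Δu = 0), and let η : ℝⁿ → ℝ be a smooth function such that at every point p ∈ ℝⁿ, the eigenvalues λ₁(p) ≤ λ₂(p) ≤ ... ≤ λₙ(p) of the Hessian D²η(p), listed in increasing order, satisfy λ₂(p) > 0 and λ₁(p) ≥ −λ₂(p)/(n−1). Then η ∘ ∇u is subharmonic on Ω: Δ(η(∇u)) ≥ 0 at every point of Ω. -/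
open scoped InnerProductSpace

noncomputable section

/-- The second derivative of `η` at `p` as a bilinear expression: `D²η(p)(ξ, ζ)`. -/
def secondDerivBilin {n : ℕ} (η : EuclideanSpace ℝ (Fin n) → ℝ)
    (p ξ ζ : EuclideanSpace ℝ (Fin n)) : ℝ :=
  fderiv ℝ (fun q => fderiv ℝ η q ζ) p ξ

/-- The second partial derivative `∂_i ∂_j u (x)`. -/
def secondPartial {n : ℕ} (u : EuclideanSpace ℝ (Fin n) → ℝ)
    (x : EuclideanSpace ℝ (Fin n)) (i j : Fin n) : ℝ :=
  fderiv ℝ (fun y => fderiv ℝ u y (EuclideanSpace.single j 1)) x (EuclideanSpace.single i 1)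

/-- A weighted sum of squares of the entries of a trace-free symmetric matrix is nonnegative if all
weights but the first are at least `c > 0` and the first one is at least `-c / m`. -/
theorem weighted_sum_sq_nonneg_of_trace_zero {m : ℕ} (hm : 1 ≤ m)
    (a : Fin (m + 1) → Fin (m + 1) → ℝ) (hsymm : ∀ k l, a k l = a l k) (htr : ∑ k, a k k = 0)
    (μ : Fin (m + 1) → ℝ) {c : ℝ} (hc : 0 < c) (hμ : ∀ k : Fin m, c ≤ μ k.succ)
    (hμ0 : -c / (m : ℝ) ≤ μ 0) :
    0 ≤ ∑ k, μ k * ∑ l, a k l ^ 2 := by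
  have hm' : (1 : ℝ) ≤ m := by exact_mod_cast hm
  have hm0 : (0 : ℝ) < m := by linarith
  rw [Fin.sum_univ_succ] at htr ⊢
  have hrow : ∀ k : Fin m, a 0 k.succ ^ 2 + a k.succ k.succ ^ 2 ≤ ∑ l, a k.succ l ^ 2 := by
    intro k
    rw [Fin.sum_univ_succ, hsymm 0 k.succ]
    gcongr
    exact Finset.single_le_sum (f := fun l : Fin m => a k.succ l.succ ^ 2)
      (fun _ _ => sq_nonneg _) (Finset.mem_univ k)
  have hcs : (∑ k : Fin m, a k.succ k.succ) ^ 2 ≤ m * ∑ k : Fin m, a k.succ k.succ ^ 2 := by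
    simpa using sq_sum_le_card_mul_sum_sq (s := Finset.univ) (f := fun k : Fin m => a k.succ k.succ)
  have h00 : a 0 0 ^ 2 = (∑ k : Fin m, a k.succ k.succ) ^ 2 := by
    rw [eq_neg_of_add_eq_zero_left htr, neg_sq]
  set D := ∑ k : Fin m, a k.succ k.succ ^ 2 with hD
  set R := ∑ k : Fin m, a 0 k.succ ^ 2 with hR
  have hR0 : 0 ≤ R := Finset.sum_nonneg fun _ _ => sq_nonneg _
  have hrest : c * (R + D) ≤ ∑ k : Fin m, μ k.succ * ∑ l, a k.succ l ^ 2 := by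
    rw [hR, hD, ← Finset.sum_add_distrib, Finset.mul_sum]
    refine Finset.sum_le_sum fun k _ => ?_
    exact mul_le_mul (hμ k) (hrow k) (by positivity) (hc.le.trans (hμ k))
  have hfirst : -c / (m : ℝ) * (a 0 0 ^ 2 + R) ≤ μ 0 * ∑ l, a 0 l ^ 2 := by
    rw [Fin.sum_univ_succ, ← hR]
    exact mul_le_mul_of_nonneg_right hμ0 (by positivity)
  have hkey : 0 ≤ -c / (m : ℝ) * (a 0 0 ^ 2 + R) + c * (R + D) := by
    have hle : (a 0 0 ^ 2 + R) / m ≤ R + D := by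
      rw [div_le_iff₀ hm0]
      nlinarith
    have := mul_le_mul_of_nonneg_left hle hc.le
    have heq : -c / (m : ℝ) * (a 0 0 ^ 2 + R) = -(c * ((a 0 0 ^ 2 + R) / m)) := by ring
    linarith
  linarith

section Gradient

variable {E : Type*} [NormedAddCommGroup E] [InnerProductSpace ℝ E]

theorem ContDiffAt.gradient [CompleteSpace E] {u : E → ℝ} {x : E}
    (hu : ContDiffAt ℝ (⊤ : ℕ∞) u x) : ContDiffAt ℝ (⊤ : ℕ∞) (gradient u) x :=
  (InnerProductSpace.toDual ℝ E).symm.contDiff.contDiffAt.comp x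
    (hu.fderiv_right (m := (⊤ : ℕ∞)) (by simp))

theorem inner_fderiv_gradient [CompleteSpace E] {u : E → ℝ} {x : E}
    (hu : ContDiffAt ℝ (⊤ : ℕ∞) u x) (ξ ζ : E) :
    ⟪fderiv ℝ (gradient u) x ξ, ζ⟫_ℝ = fderiv ℝ (fun y => fderiv ℝ u y ζ) x ξ := by
  have hd : DifferentiableAt ℝ (gradient u) x := hu.gradient.differentiableAt (by simp)
  have h : (fun y => fderiv ℝ u y ζ) = fun y => ⟪gradient u y, ζ⟫_ℝ := by
    ext y
    simp [gradient]
  rw [h, fderiv_inner_apply ℝ hd (differentiableAt_const ζ)]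
  simp

theorem fderiv_fderiv_apply_const {F : Type*} [NormedAddCommGroup F] [NormedSpace ℝ F]
    {f : E → F} {x : E} (hf : ContDiffAt ℝ (⊤ : ℕ∞) f x) (ξ ζ : E) :
    fderiv ℝ (fun y => fderiv ℝ f y ζ) x ξ = fderiv ℝ (fderiv ℝ f) x ξ ζ := by
  have hd : DifferentiableAt ℝ (fderiv ℝ f) x :=
    (hf.fderiv_right (m := (⊤ : ℕ∞)) (by simp)).differentiableAt (by simp)
  rw [fderiv_clm_apply hd (differentiableAt_const ζ)]
  simp

theorem fderiv_fderiv_apply_comm {F : Type*} [NormedAddCommGroup F] [NormedSpace ℝ F]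
    {f : E → F} {x : E} (hf : ContDiffAt ℝ (⊤ : ℕ∞) f x) (ξ ζ : E) :
    fderiv ℝ (fderiv ℝ f) x ξ ζ = fderiv ℝ (fderiv ℝ f) x ζ ξ :=
  (hf.isSymmSndFDerivAt (by
    rw [minSmoothness_of_isRCLikeNormedField]
    exact WithTop.coe_le_coe.2 (le_top (a := (2 : ℕ∞))))) ξ ζ

theorem inner_fderiv_gradient_comm [CompleteSpace E] {u : E → ℝ} {x : E}
    (hu : ContDiffAt ℝ (⊤ : ℕ∞) u x) (ξ ζ : E) :
    ⟪fderiv ℝ (gradient u) x ξ, ζ⟫_ℝ = ⟪fderiv ℝ (gradient u) x ζ, ξ⟫_ℝ := by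
  rw [inner_fderiv_gradient hu, inner_fderiv_gradient hu, fderiv_fderiv_apply_const hu,
    fderiv_fderiv_apply_const hu, fderiv_fderiv_apply_comm hu]

theorem inner_fderiv_fderiv_apply {f : E → E} {x : E} (hf : ContDiffAt ℝ (⊤ : ℕ∞) f x)
    (ξ ζ ω : E) :
    ⟪fderiv ℝ (fderiv ℝ f) x ξ ζ, ω⟫_ℝ = fderiv ℝ (fun y => ⟪fderiv ℝ f y ζ, ω⟫_ℝ) x ξ := by
  have hd : DifferentiableAt ℝ (fderiv ℝ f) x :=
    (hf.fderiv_right (m := (⊤ : ℕ∞)) (by simp)).differentiableAt (by simp)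
  rw [fderiv_inner_apply ℝ (hd.clm_apply (differentiableAt_const ζ)) (differentiableAt_const ω),
    fderiv_fderiv_apply_const hf]
  simp

/-- The components of the gradient of a harmonic function are harmonic. -/
theorem sum_fderiv_fderiv_gradient_eq_zero [CompleteSpace E] {ι : Type*} [Fintype ι]
    (e : OrthonormalBasis ι ℝ E) {Ω : Set E} (hΩ : IsOpen Ω) {u : E → ℝ}
    (hu : ∀ x ∈ Ω, ContDiffAt ℝ (⊤ : ℕ∞) u x)
    (hharm : ∀ x ∈ Ω, ∑ i, ⟪fderiv ℝ (gradient u) x (e i), e i⟫_ℝ = 0) {x : E} (hx : x ∈ Ω) :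
    ∑ i, fderiv ℝ (fderiv ℝ (gradient u)) x (e i) (e i) = 0 := by
  have hv := (hu x hx).gradient
  have hd : DifferentiableAt ℝ (fderiv ℝ (gradient u)) x :=
    (hv.fderiv_right (m := (⊤ : ℕ∞)) (by simp)).differentiableAt (by simp)
  refine ext_inner_right ℝ fun ω => ?_
  have hswap : ∀ i, ⟪fderiv ℝ (fderiv ℝ (gradient u)) x (e i) (e i), ω⟫_ℝ =
      fderiv ℝ (fun y => ⟪fderiv ℝ (gradient u) y (e i), e i⟫_ℝ) x ω := by
    intro i
    have hev : (fun y => ⟪fderiv ℝ (gradient u) y (e i), ω⟫_ℝ) =ᶠ[nhds x]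
        fun y => ⟪fderiv ℝ (gradient u) y ω, e i⟫_ℝ := by
      filter_upwards [hΩ.mem_nhds hx] with y hy
      exact inner_fderiv_gradient_comm (hu y hy) _ _
    rw [inner_fderiv_fderiv_apply hv, hev.fderiv_eq, ← inner_fderiv_fderiv_apply hv,
      fderiv_fderiv_apply_comm hv, inner_fderiv_fderiv_apply hv]
  have hzero : (fun y => ∑ i, ⟪fderiv ℝ (gradient u) y (e i), e i⟫_ℝ) =ᶠ[nhds x]
      fun _ => (0 : ℝ) := by
    filter_upwards [hΩ.mem_nhds hx] with y hy using hharm y hy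
  have hsum : fderiv ℝ (fun y => ∑ i, ⟪fderiv ℝ (gradient u) y (e i), e i⟫_ℝ) x =
      ∑ i, fderiv ℝ (fun y => ⟪fderiv ℝ (gradient u) y (e i), e i⟫_ℝ) x :=
    fderiv_fun_sum fun i _ =>
      (hd.clm_apply (differentiableAt_const (e i))).inner ℝ (differentiableAt_const (e i))
  rw [sum_inner, inner_zero_left, Finset.sum_congr rfl fun i _ => hswap i,
    ← sum_apply, ← hsum, hzero.fderiv_eq]
  simp

/-- Second-order chain rule. -/
theorem fderiv_fderiv_comp_apply {η : E → ℝ} (hη : ContDiff ℝ (⊤ : ℕ∞) η) {v : E → E} {x : E}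
    (hv : ContDiffAt ℝ (⊤ : ℕ∞) v x) (ξ ζ : E) :
    fderiv ℝ (fun y => fderiv ℝ (fun z => η (v z)) y ζ) x ξ =
      fderiv ℝ (fderiv ℝ η) (v x) (fderiv ℝ v x ξ) (fderiv ℝ v x ζ) +
        fderiv ℝ η (v x) (fderiv ℝ (fderiv ℝ v) x ξ ζ) := by
  have hev : (fun y => fderiv ℝ (fun z => η (v z)) y ζ) =ᶠ[nhds x]
      fun y => fderiv ℝ η (v y) (fderiv ℝ v y ζ) := by
    have hv1 : ContDiffAt ℝ 1 v x := hv.of_le (by exact_mod_cast le_top)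
    filter_upwards [hv1.eventually (by simp)] with y hy
    have hηd : DifferentiableAt ℝ η (v y) := hη.differentiable (by simp) _
    have := fderiv_comp y hηd (hy.differentiableAt (by simp))
    exact congrArg (fun L => L ζ) this
  have hη' : DifferentiableAt ℝ (fderiv ℝ η) (v x) :=
    (hη.fderiv_right (m := (⊤ : ℕ∞)) (by simp)).differentiable (by simp) _
  have hvd : DifferentiableAt ℝ v x := hv.differentiableAt (by simp)
  have hd : DifferentiableAt ℝ (fderiv ℝ v) x :=
    (hv.fderiv_right (m := (⊤ : ℕ∞)) (by simp)).differentiableAt (by simp)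
  have hηv : DifferentiableAt ℝ (fun y => fderiv ℝ η (v y)) x := hη'.comp x hvd
  have hcomp : fderiv ℝ (fun y => fderiv ℝ η (v y)) x =
      (fderiv ℝ (fderiv ℝ η) (v x)).comp (fderiv ℝ v x) := fderiv_comp x hη' hvd
  rw [hev.fderiv_eq, fderiv_clm_apply hηv (hd.clm_apply (differentiableAt_const ζ)),
    add_apply, ContinuousLinearMap.comp_apply, fderiv_fderiv_apply_const hv,
    ContinuousLinearMap.flip_apply]
  rw [hcomp, ContinuousLinearMap.comp_apply, add_comm]

end Gradient

/-- For a symmetric operator `A`, the sum `∑ i, ⟪w, A eᵢ⟫²` does not depend on the orthonormal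
basis. -/
theorem sum_inner_sq_eq_of_symm {E ι κ : Type*} [NormedAddCommGroup E] [InnerProductSpace ℝ E]
    [Fintype ι] [Fintype κ] (e : OrthonormalBasis ι ℝ E) (b : OrthonormalBasis κ ℝ E)
    {A : E →L[ℝ] E} (hA : ∀ ξ ζ, ⟪A ξ, ζ⟫_ℝ = ⟪A ζ, ξ⟫_ℝ) (w : E) :
    ∑ i, ⟪w, A (e i)⟫_ℝ ^ 2 = ∑ k, ⟪A w, b k⟫_ℝ ^ 2 := by
  have h : ∀ i, ⟪w, A (e i)⟫_ℝ = ⟪A w, e i⟫_ℝ := fun i => by rw [real_inner_comm, hA]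
  simp only [h, OrthonormalBasis.sum_sq_inner_left]

/-- If `u` is harmonic and the Hessian eigenvalues `λ₁ ≤ λ₂ ≤ ⋯ ≤ λₙ` of `η` satisfy
`λ₂ > 0` and `λ₁ ≥ -λ₂/(n-1)` everywhere, then `η(∇u)` is subharmonic. -/
theorem almost_convex_of_gradient_subharmonic (n : ℕ) (hn : 2 ≤ n)
    (Ω : Set (EuclideanSpace ℝ (Fin n))) (hΩ : IsOpen Ω)
    (u : EuclideanSpace ℝ (Fin n) → ℝ) (hu : ContDiffOn ℝ (⊤ : ℕ∞) u Ω)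
    (hharm : ∀ x ∈ Ω, ∑ i, secondPartial u x i i = 0)
    (η : EuclideanSpace ℝ (Fin n) → ℝ) (hη : ContDiff ℝ (⊤ : ℕ∞) η)
    (hηeig : ∀ p : EuclideanSpace ℝ (Fin n),
      ∃ (μ : Fin n → ℝ) (b : Fin n → EuclideanSpace ℝ (Fin n)),
        Monotone μ ∧ Orthonormal ℝ b ∧
        (∀ ξ ζ : EuclideanSpace ℝ (Fin n),
          secondDerivBilin η p ξ ζ = ∑ k, μ k * ⟪b k, ξ⟫_ℝ * ⟪b k, ζ⟫_ℝ) ∧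
        0 < μ ⟨1, by omega⟩ ∧
        -(μ ⟨1, by omega⟩) / ((n : ℝ) - 1) ≤ μ ⟨0, by omega⟩) :
    ∀ x ∈ Ω, 0 ≤ ∑ i, secondPartial (fun z => η (gradient u z)) x i i := by
  intro x hx
  have hu' : ∀ y ∈ Ω, ContDiffAt ℝ (⊤ : ℕ∞) u y := fun y hy => hu.contDiffAt (hΩ.mem_nhds hy)
  let e := EuclideanSpace.basisFun (Fin n) ℝ
  have he : ∀ i, EuclideanSpace.single i (1 : ℝ) = e i := fun i => by simp [e]
  have hharm' : ∀ y ∈ Ω, ∑ i, ⟪fderiv ℝ (gradient u) y (e i), e i⟫_ℝ = 0 := by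
    intro y hy
    rw [← hharm y hy]
    refine Finset.sum_congr rfl fun i _ => ?_
    rw [inner_fderiv_gradient (hu' y hy), secondPartial, he]
  obtain ⟨μ, b, hmono, hb, hform, hpos, hlow⟩ := hηeig (gradient u x)
  obtain ⟨B, hB⟩ : ∃ B : OrthonormalBasis (Fin n) ℝ (EuclideanSpace ℝ (Fin n)), ∀ k, B k = b k := by
    obtain ⟨B, hB⟩ := Orthonormal.exists_orthonormalBasis_extension_of_card_eq
      (𝕜 := ℝ) (E := EuclideanSpace ℝ (Fin n)) (ι := Fin n) (v := b) (s := Set.univ)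
      (by simp) (hb.comp _ Subtype.val_injective)
    exact ⟨B, fun k => hB k (Set.mem_univ k)⟩
  set A := fderiv ℝ (gradient u) x
  have hA : ∀ ξ ζ, ⟪A ξ, ζ⟫_ℝ = ⟪A ζ, ξ⟫_ℝ := inner_fderiv_gradient_comm (hu' x hx)
  have hlap : ∑ i, secondPartial (fun z => η (gradient u z)) x i i =
      ∑ k, μ k * ∑ l, ⟪A (B k), B l⟫_ℝ ^ 2 := by
    have hterm : ∀ i, secondPartial (fun z => η (gradient u z)) x i i =
        ∑ k, μ k * ⟪B k, A (e i)⟫_ℝ ^ 2 +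
          fderiv ℝ η (gradient u x) (fderiv ℝ (fderiv ℝ (gradient u)) x (e i) (e i)) := by
      intro i
      rw [secondPartial, he, fderiv_fderiv_comp_apply hη (hu' x hx).gradient,
        ← fderiv_fderiv_apply_const hη.contDiffAt]
      congr 1
      refine (hform _ _).trans (Finset.sum_congr rfl fun k _ => ?_)
      rw [hB]
      ring
    rw [Finset.sum_congr rfl fun i _ => hterm i, Finset.sum_add_distrib, ← map_sum,
      sum_fderiv_fderiv_gradient_eq_zero e hΩ hu' hharm' hx, map_zero, add_zero,
      Finset.sum_comm]
    refine Finset.sum_congr rfl fun k _ => ?_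
    rw [← Finset.mul_sum, sum_inner_sq_eq_of_symm e B hA]
  have htr : ∑ k, ⟪A (B k), B k⟫_ℝ = 0 := by
    have h1 := LinearMap.trace_eq_sum_inner (A : EuclideanSpace ℝ (Fin n) →ₗ[ℝ] _) B
    have h2 := LinearMap.trace_eq_sum_inner (A : EuclideanSpace ℝ (Fin n) →ₗ[ℝ] _) e
    rw [← hharm' x hx]
    refine Eq.trans ?_ ((h1.symm.trans h2).trans ?_) <;>
      exact Finset.sum_congr rfl fun _ _ => real_inner_comm _ _
  rw [hlap]
  obtain ⟨m, rfl⟩ : ∃ m, n = m + 1 := ⟨n - 1, by omega⟩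
  refine weighted_sum_sq_nonneg_of_trace_zero (by omega) (fun k l => ⟪A (B k), B l⟫_ℝ)
    (fun k l => hA _ _) htr μ hpos (fun k => hmono ?_) ?_
  · rw [Fin.le_def]
    simp
  · simpa using hlow
end
end
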